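/- arXiv:1005.0084 — 4 statements merged into one kernel-verified Lean document; each statement's English description precedes it below -/
import Mathlib

section
/- Let x, y, z, t, u, w be positive integers satisfying x² + y² + z² = t², x² + z² = w², y² + z² = u², gcd(x, z) = 1 and gcd(y, z) = 1 (i.e., (x, y, z, t, s, u, w) is a Pythagorean box whose two pairs of faces (x, z, w) and (y, z, u) are primitive Pythagorean rectangles). Then there exist positive integers M₁, N₁, M₂, N₂ and an odd positive integer δ such that M₁² + N₁² + δ·N₂² = δ·M₂², gcd(M₁, N₁) = 1 = gcd(M₂, N₂), M₁ + N₁ ≡ 1 (mod 2), M₂ + N₂ ≡ 1 (mod 2), x = 2M₁N₁, y = 2δM₂N₂, z = M₁² − N₁², w = M₁² + N₁², t = δ(M₂² + N₂²), and u² = (M₁² − N₁²)² + (2δM₂N₂)². -/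
/-- The classification of primitive Pythagorean triples of positive natural numbers, the leg `b`
being the odd one. -/
theorem Nat.exists_eq_of_coprime_pythagorean {a b c : ℕ} (ha : 0 < a) (hb : Odd b)
    (h : a ^ 2 + b ^ 2 = c ^ 2) (hab : Nat.gcd a b = 1) :
    ∃ m n : ℕ, 0 < m ∧ 0 < n ∧ Nat.gcd m n = 1 ∧ (m + n) % 2 = 1 ∧
      a = 2 * m * n ∧ b + n ^ 2 = m ^ 2 ∧ c = m ^ 2 + n ^ 2 := by
  have hc : 0 < c := by
    by_contra! hc
    have : 0 < a ^ 2 := by positivity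
    simp_all
  have htriple : PythagoreanTriple (b : ℤ) a c := by
    unfold PythagoreanTriple
    zify at h
    linarith
  obtain ⟨m, n, hbm, ham, hcm, hmn, hpar, hm⟩ := htriple.coprime_classification'
    (by rw [Int.gcd_natCast_natCast, Nat.gcd_comm, hab])
    (by have := Nat.odd_iff.mp hb; omega) (by exact_mod_cast hc)
  have ha' : (0 : ℤ) < 2 * m * n := by rw [← ham]; exact_mod_cast ha
  have hm' : 0 < m := lt_of_le_of_ne hm (by rintro rfl; simp at ha')
  have hn' : 0 < n := pos_of_mul_pos_right ha' (by positivity)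
  lift m to ℕ using hm
  lift n to ℕ using hn'.le
  refine ⟨m, n, by exact_mod_cast hm', by exact_mod_cast hn',
    by simpa using hmn, by omega, by exact_mod_cast ham, ?_, by exact_mod_cast hcm⟩
  zify
  linarith

/-- A Pythagorean triple of positive natural numbers with an odd leg `b` is an odd multiple of a
primitive one. -/
theorem Nat.exists_eq_mul_of_pythagorean {a b c : ℕ} (ha : 0 < a) (hb : Odd b)
    (h : a ^ 2 + b ^ 2 = c ^ 2) :
    ∃ m n d : ℕ, 0 < m ∧ 0 < n ∧ Odd d ∧ Nat.gcd m n = 1 ∧ (m + n) % 2 = 1 ∧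
      a = 2 * d * m * n ∧ b + d * n ^ 2 = d * m ^ 2 ∧ c = d * (m ^ 2 + n ^ 2) := by
  have hd : 0 < Nat.gcd a b := Nat.gcd_pos_of_pos_left b ha
  obtain ⟨a', b', hcop, ha', hb'⟩ := Nat.exists_coprime a b
  set d := Nat.gcd a b
  obtain ⟨c', rfl⟩ : d ∣ c := by
    rw [← Nat.pow_dvd_pow_iff two_ne_zero, ← h]
    exact dvd_add (pow_dvd_pow_of_dvd ⟨a', by rw [ha', mul_comm]⟩ 2)
      (pow_dvd_pow_of_dvd ⟨b', by rw [hb', mul_comm]⟩ 2)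
  rw [hb', Nat.odd_mul] at hb
  have h' : a' ^ 2 + b' ^ 2 = c' ^ 2 := by
    apply Nat.eq_of_mul_eq_mul_left (pow_pos hd 2)
    rw [ha', hb'] at h
    linarith
  obtain ⟨m, n, hm, hn, hmn, hpar, ham, hbm, hcm⟩ := Nat.exists_eq_of_coprime_pythagorean
    (Nat.pos_of_mul_pos_right (ha' ▸ ha)) hb.1 h' hcop
  refine ⟨m, n, d, hm, hn, hb.2, hmn, hpar, ?_, ?_, by rw [hcm]⟩
  · rw [ha', ham]; ring
  · rw [hb', ← hbm]; ring

/-- The sum of the squares of two odd numbers is not a square. -/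
theorem Nat.sq_add_sq_ne_sq_of_odd {a b : ℕ} (ha : Odd a) (hb : Odd b) (c : ℕ) :
    a ^ 2 + b ^ 2 ≠ c ^ 2 := by
  intro h
  have ha4 : a ^ 2 % 4 = 1 := by
    rcases Nat.odd_mod_four_iff.mp (Nat.odd_iff.mp ha) with h | h <;> simp [Nat.pow_mod, h]
  have hb4 : b ^ 2 % 4 = 1 := by
    rcases Nat.odd_mod_four_iff.mp (Nat.odd_iff.mp hb) with h | h <;> simp [Nat.pow_mod, h]
  have hc4 : c ^ 2 % 4 = 0 ∨ c ^ 2 % 4 = 1 := by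
    have : c % 4 < 4 := Nat.mod_lt c (by norm_num)
    interval_cases hc : c % 4 <;> simp [Nat.pow_mod, hc]
  omega


/-- Result 1: A Pythagorean box whose two pairs of faces `(x, z, w)` and `(y, z, u)`
are primitive Pythagorean rectangles admits the stated parametrization. -/
theorem pythagorean_box_two_primitive_faces
    (x y z t u w : ℕ)
    (hx : 0 < x) (hy : 0 < y) (hz : 0 < z) (ht : 0 < t) (hu : 0 < u) (hw : 0 < w)
    (h1 : x ^ 2 + y ^ 2 + z ^ 2 = t ^ 2)
    (h2 : x ^ 2 + z ^ 2 = w ^ 2)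
    (h3 : y ^ 2 + z ^ 2 = u ^ 2)
    (h4 : Nat.gcd x z = 1) (h5 : Nat.gcd y z = 1) :
    ∃ M₁ N₁ M₂ N₂ δ : ℕ,
      0 < M₁ ∧ 0 < N₁ ∧ 0 < M₂ ∧ 0 < N₂ ∧ 0 < δ ∧ Odd δ ∧
      M₁ ^ 2 + N₁ ^ 2 + δ * N₂ ^ 2 = δ * M₂ ^ 2 ∧
      Nat.gcd M₁ N₁ = 1 ∧ Nat.gcd M₂ N₂ = 1 ∧
      (M₁ + N₁) % 2 = 1 ∧ (M₂ + N₂) % 2 = 1 ∧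
      x = 2 * M₁ * N₁ ∧ y = 2 * δ * M₂ * N₂ ∧
      z = M₁ ^ 2 - N₁ ^ 2 ∧ w = M₁ ^ 2 + N₁ ^ 2 ∧
      t = δ * (M₂ ^ 2 + N₂ ^ 2) ∧
      u ^ 2 = (M₁ ^ 2 - N₁ ^ 2) ^ 2 + (2 * δ * M₂ * N₂) ^ 2 := by
  have odd_of_sq {n : ℕ} (h : Odd (n ^ 2)) : Odd n := (Nat.odd_pow_iff two_ne_zero).mp h
  have h1' : y ^ 2 + w ^ 2 = t ^ 2 := by rw [← h1, ← h2]; ring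
  have hz_odd : Odd z := by
    by_contra hz_even
    rw [Nat.not_odd_iff_even] at hz_even
    have hx_odd : Odd x := (Nat.Coprime.coprime_dvd_right hz_even.two_dvd h4).odd_of_right
    have hy_odd : Odd y := (Nat.Coprime.coprime_dvd_right hz_even.two_dvd h5).odd_of_right
    have hw_odd : Odd w := odd_of_sq (h2 ▸ hx_odd.pow.add_even (hz_even.pow_of_ne_zero two_ne_zero))
    exact Nat.sq_add_sq_ne_sq_of_odd hy_odd hw_odd t h1'
  have hx_even : Even x := by
    by_contra hx_odd
    exact Nat.sq_add_sq_ne_sq_of_odd (Nat.not_even_iff_odd.mp hx_odd) hz_odd w h2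
  have hw_odd : Odd w := odd_of_sq (h2 ▸ (hx_even.pow_of_ne_zero two_ne_zero).add_odd hz_odd.pow)
  obtain ⟨M₁, N₁, hM₁, hN₁, hgcd₁, hpar₁, hxM, hzM, hwM⟩ :=
    Nat.exists_eq_of_coprime_pythagorean hx hz_odd h2 h4
  obtain ⟨M₂, N₂, δ, hM₂, hN₂, hδ, hgcd₂, hpar₂, hyM, hwM₂, htM⟩ :=
    Nat.exists_eq_mul_of_pythagorean hy hw_odd h1'
  have hz_eq : z = M₁ ^ 2 - N₁ ^ 2 := Nat.eq_sub_of_add_eq hzM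
  refine ⟨M₁, N₁, M₂, N₂, δ, hM₁, hN₁, hM₂, hN₂, hδ.pos, hδ, by rw [← hwM, hwM₂], hgcd₁, hgcd₂,
    hpar₁, hpar₂, hxM, hyM, hz_eq, hwM, htM, ?_⟩
  rw [← hz_eq, ← hyM, ← h3, add_comm]
end

section
/- Let M₁, N₁, M₂, N₂ be positive integers satisfying gcd(M₁, N₁) = 1, M₁ + N₁ ≡ 1 (mod 2), M₁ > N₁, and M₁² + N₁² + N₂² = M₂². Define x = 2M₁N₁, y = 2M₂N₂, z = M₁² − N₁², w = M₁² + N₁², and t = M₁² + N₁² + 2N₂². Then x² + y² + z² = t², x² + z² = w², and gcd(x, z) = 1; that is, (x, y, z, t) is a Pythagorean box one pair of whose opposite faces, the pair characterized by (x, z, w), consists of primitive Pythagorean rectangles. -/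
/-- Euclid's identity over the natural numbers. -/
theorem two_mul_sq_add_sq_sub_sq {m n : ℕ} (h : n ≤ m) :
    (2 * m * n) ^ 2 + (m ^ 2 - n ^ 2) ^ 2 = (m ^ 2 + n ^ 2) ^ 2 := by
  zify [Nat.pow_le_pow_left h 2]
  ring

/-- The legs given by Euclid's formula are coprime when the parameters are coprime and of
opposite parity. -/
theorem coprime_two_mul_sq_sub_sq {m n : ℕ} (hmn : m.Coprime n) (hpar : (m + n) % 2 = 1)
    (h : n ≤ m) : (2 * m * n).Coprime (m ^ 2 - n ^ 2) := by
  rw [Nat.sq_sub_sq]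
  refine .mul_left (.mul_left (.mul_right ?_ ?_) (.mul_right ?_ ?_)) (.mul_right ?_ ?_)
  · exact Nat.coprime_two_left.mpr (Nat.odd_iff.mpr hpar)
  · exact Nat.coprime_two_left.mpr (Nat.odd_iff.mpr (by omega))
  · simpa using hmn
  · exact (Nat.coprime_self_sub_right h).mpr hmn
  · simpa using hmn.symm
  · exact (Nat.coprime_sub_self_right h).mpr hmn.symm

/-- Result 2: the parametrization produces a Pythagorean box with a pair of
opposite faces which are primitive Pythagorean rectangles. -/
theorem pythagorean_box_from_parameters
    (M₁ N₁ M₂ N₂ : ℕ)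
    (hM₁ : 0 < M₁) (hN₁ : 0 < N₁) (hM₂ : 0 < M₂) (hN₂ : 0 < N₂)
    (hgcd : Nat.gcd M₁ N₁ = 1) (hpar : (M₁ + N₁) % 2 = 1) (hlt : N₁ < M₁)
    (heq : M₁ ^ 2 + N₁ ^ 2 + N₂ ^ 2 = M₂ ^ 2) :
    (2 * M₁ * N₁) ^ 2 + (2 * M₂ * N₂) ^ 2 + (M₁ ^ 2 - N₁ ^ 2) ^ 2
        = (M₁ ^ 2 + N₁ ^ 2 + 2 * N₂ ^ 2) ^ 2 ∧
    (2 * M₁ * N₁) ^ 2 + (M₁ ^ 2 - N₁ ^ 2) ^ 2 = (M₁ ^ 2 + N₁ ^ 2) ^ 2 ∧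
    Nat.gcd (2 * M₁ * N₁) (M₁ ^ 2 - N₁ ^ 2) = 1 := by
  have second : (2 * M₁ * N₁) ^ 2 + (M₁ ^ 2 - N₁ ^ 2) ^ 2 = (M₁ ^ 2 + N₁ ^ 2) ^ 2 :=
    two_mul_sq_add_sq_sub_sq hlt.le
  refine ⟨?_, second, coprime_two_mul_sq_sub_sq hgcd hpar hlt.le⟩
  rw [add_right_comm, second, mul_pow, mul_pow, ← heq]
  ring
end

section
/- Let x, y, z, t, u, w be positive integers with x² + y² + z² = t², x² + z² = w², y² + z² = u², gcd(x, z) = 1 and gcd(y, z) = 1. Then x and y are even, while z, t, w, and u are all odd. -/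
theorem sq_mod_four_cases (n : ℕ) :
    n ^ 2 % 4 = 0 ∧ n % 2 = 0 ∨ n ^ 2 % 4 = 1 ∧ n % 2 = 1 := by
  have h : n % 4 = 0 ∨ n % 4 = 1 ∨ n % 4 = 2 ∨ n % 4 = 3 := by omega
  rcases h with h | h | h | h <;> simp [Nat.pow_mod, h] <;> omega

theorem mod_two_eq_one_or_of_gcd_eq_one {a b : ℕ} (h : Nat.gcd a b = 1) :
    a % 2 = 1 ∨ b % 2 = 1 := by
  by_contra hc
  have h2 : 2 ∣ Nat.gcd a b := Nat.dvd_gcd (by omega) (by omega)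
  omega

/-- Parity facts for a Pythagorean box whose faces `(x, z, w)` and `(y, z, u)`
are primitive Pythagorean rectangles. -/
theorem parity_of_box_with_two_primitive_faces
    (x y z t u w : ℕ)
    (hx : 0 < x) (hy : 0 < y) (hz : 0 < z) (ht : 0 < t) (hu : 0 < u) (hw : 0 < w)
    (h1 : x ^ 2 + y ^ 2 + z ^ 2 = t ^ 2)
    (h2 : x ^ 2 + z ^ 2 = w ^ 2)
    (h3 : y ^ 2 + z ^ 2 = u ^ 2)
    (h4 : Nat.gcd x z = 1) (h5 : Nat.gcd y z = 1) :
    Even x ∧ Even y ∧ Odd z ∧ Odd t ∧ Odd w ∧ Odd u := by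
  have hxz := mod_two_eq_one_or_of_gcd_eq_one h4
  have hyz := mod_two_eq_one_or_of_gcd_eq_one h5
  have sx := sq_mod_four_cases x
  have sy := sq_mod_four_cases y
  have sz := sq_mod_four_cases z
  have st := sq_mod_four_cases t
  have su := sq_mod_four_cases u
  have sw := sq_mod_four_cases w
  simp only [Nat.even_iff, Nat.odd_iff]
  generalize x ^ 2 = X at *
  generalize y ^ 2 = Y at *
  generalize z ^ 2 = Z at *
  generalize t ^ 2 = T at *
  generalize u ^ 2 = U at *
  generalize w ^ 2 = W at *
  omega
end

section
/- There exist infinitely many quadruples (x, y, z, t) of positive integers such that x² + y² + z² = t², x² + z² is a perfect square, and gcd(x, z) = 1. In other words, there exist infinitely many Pythagorean boxes containing a pair of opposite faces which are primitive Pythagorean rectangles. -/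
/-- There exist infinitely many Pythagorean boxes containing a pair of opposite
faces which are primitive Pythagorean rectangles. -/
theorem infinitely_many_boxes_with_primitive_faces :
    {q : ℕ × ℕ × ℕ × ℕ |
        0 < q.1 ∧ 0 < q.2.1 ∧ 0 < q.2.2.1 ∧ 0 < q.2.2.2 ∧
        q.1 ^ 2 + q.2.1 ^ 2 + q.2.2.1 ^ 2 = q.2.2.2 ^ 2 ∧
        (∃ w : ℕ, q.1 ^ 2 + q.2.2.1 ^ 2 = w ^ 2) ∧
        Nat.gcd q.1 q.2.2.1 = 1}.Infinite := by
  refine Set.infinite_of_injective_forall_mem (f := fun n : ℕ ↦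
    (2 * n + 3, 2 * ((n + 1) * (n + 2)) * ((n + 1) * (n + 2) + 1), 2 * ((n + 1) * (n + 2)),
      2 * ((n + 1) * (n + 2)) * ((n + 1) * (n + 2) + 1) + 1)) ?_ ?_
  · intro a b h
    have h₁ : 2 * a + 3 = 2 * b + 3 := congrArg Prod.fst h
    omega
  · intro n
    refine ⟨by positivity, by positivity, by positivity, by positivity, by ring,
      ⟨2 * ((n + 1) * (n + 2)) + 1, by ring⟩, ?_⟩
    rw [← Nat.coprime_iff_gcd_eq_one, ← Nat.isCoprime_iff_coprime]
    exact ⟨2 * n + 3, -2, by push_cast; ring⟩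
end
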